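/- Let f, c be C² and suppose (x, v, s) satisfies ‖(∇f(x) − ∑_i s_i∇c_i(x), 2 s⊙v)‖ ≤ ε₁ and ‖c(x) − v⊙v‖ ≤ ε₂. Then: (a) ‖∇f(x) − ∑_i s_i ∇c_i(x)‖ ≤ ε₁; (b) c_i(x) ≥ −ε₂ for every i; and (c) ‖s ⊙ c(x)‖ ≤ (ε₁/2)·max_i √(|c_i(x)| + ε₂) + ε₂·‖s‖_∞. -/

import Mathlib

theorem sqrt_sum_add_sq_le {ι : Type*} [Fintype ι] (a b : ι → ℝ) :
    Real.sqrt (∑ i, (a i + b i) ^ 2) ≤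
      Real.sqrt (∑ i, a i ^ 2) + Real.sqrt (∑ i, b i ^ 2) := by
  simpa [EuclideanSpace.norm_eq] using norm_add_le (WithLp.toLp 2 a) (WithLp.toLp 2 b)

theorem sqrt_sum_mul_sq_le {ι : Type*} [Fintype ι] (a b : ι → ℝ) {A B : ℝ}
    (hA : Real.sqrt (∑ i, a i ^ 2) ≤ A) (hB : 0 ≤ B) (hb : ∀ i, |b i| ≤ B) :
    Real.sqrt (∑ i, (a i * b i) ^ 2) ≤ A * B := by
  calc
    Real.sqrt (∑ i, (a i * b i) ^ 2) ≤ Real.sqrt ((∑ i, a i ^ 2) * B ^ 2) := by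
      rw [Finset.sum_mul]
      gcongr with i
      rw [mul_pow]
      exact mul_le_mul_of_nonneg_left (sq_le_sq' (abs_le.mp (hb i)).1 (abs_le.mp (hb i)).2)
        (sq_nonneg _)
    _ = Real.sqrt (∑ i, a i ^ 2) * B := by
      rw [Real.sqrt_mul (Finset.sum_nonneg fun _ _ => sq_nonneg _), Real.sqrt_sq hB]
    _ ≤ A * B := by gcongr

theorem abs_le_sqrt_sum_sq {ι : Type*} [Fintype ι] (a : ι → ℝ) (i : ι) :
    |a i| ≤ Real.sqrt (∑ j, a j ^ 2) :=
  Real.abs_le_sqrt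
    (Finset.single_le_sum (f := fun j => a j ^ 2) (fun _ _ => sq_nonneg _) (Finset.mem_univ i))

theorem stmt17 {n m : ℕ} [NeZero m] (f : (Fin n → ℝ) → ℝ) (c : (Fin n → ℝ) → Fin m → ℝ)
    (hf : ContDiff ℝ 2 f) (hc : ContDiff ℝ 2 c)
    (x : Fin n → ℝ) (v s : Fin m → ℝ) (ε₁ ε₂ : ℝ) (hε₁ : 0 < ε₁) (hε₂ : 0 < ε₂)
    (gradL : Fin n → ℝ)
    (hgradL : ∀ j, gradL j =
      fderiv ℝ f x (Pi.single j 1) - ∑ i, s i * fderiv ℝ (fun y => c y i) x (Pi.single j 1))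
    (h1 : Real.sqrt ((∑ j, (gradL j) ^ 2) + ∑ i, (2 * s i * v i) ^ 2) ≤ ε₁)
    (h2 : Real.sqrt (∑ i, (c x i - v i * v i) ^ 2) ≤ ε₂) :
    Real.sqrt (∑ j, (gradL j) ^ 2) ≤ ε₁ ∧
    (∀ i, -ε₂ ≤ c x i) ∧
    Real.sqrt (∑ i, (s i * c x i) ^ 2) ≤
      ε₁ / 2 * (Finset.univ.sup' Finset.univ_nonempty
        (fun i : Fin m => Real.sqrt (|c x i| + ε₂)))
      + ε₂ * (Finset.univ.sup' Finset.univ_nonempty (fun i : Fin m => |s i|)) := by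
  have hres : ∀ i, |c x i - v i * v i| ≤ ε₂ := fun i =>
    (abs_le_sqrt_sum_sq (fun i => c x i - v i * v i) i).trans h2
  set V := Finset.univ.sup' Finset.univ_nonempty (fun i : Fin m => Real.sqrt (|c x i| + ε₂))
  set S := Finset.univ.sup' Finset.univ_nonempty (fun i : Fin m => |s i|)
  have hv : ∀ i, |v i| ≤ V := fun i => by
    refine le_trans (Real.abs_le_sqrt ?_)
      (Finset.le_sup' (fun i : Fin m => Real.sqrt (|c x i| + ε₂)) (Finset.mem_univ i))
    linarith [(abs_le.mp (hres i)).1, le_abs_self (c x i), sq (v i)]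
  have hs : ∀ i, |s i| ≤ S := fun i =>
    Finset.le_sup' (fun i : Fin m => |s i|) (Finset.mem_univ i)
  have hV0 : 0 ≤ V := (abs_nonneg _).trans (hv 0)
  have hS0 : 0 ≤ S := (abs_nonneg _).trans (hs 0)
  have hsv : Real.sqrt (∑ i, (s i * v i) ^ 2) ≤ ε₁ / 2 := by
    have h : Real.sqrt (∑ i, (2 * s i * v i) ^ 2) ≤ ε₁ :=
      (Real.sqrt_le_sqrt (le_add_of_nonneg_left (Finset.sum_nonneg fun _ _ => sq_nonneg _))).trans
        h1
    have heq : ∑ i, (2 * s i * v i) ^ 2 = 2 ^ 2 * ∑ i, (s i * v i) ^ 2 := by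
      rw [Finset.mul_sum]
      exact Finset.sum_congr rfl fun i _ => by ring
    rw [heq, Real.sqrt_mul (by positivity), Real.sqrt_sq (by norm_num)] at h
    linarith
  refine ⟨?_, fun i => ?_, ?_⟩
  · exact (Real.sqrt_le_sqrt
      (le_add_of_nonneg_right (Finset.sum_nonneg fun _ _ => sq_nonneg _))).trans h1
  · linarith [(abs_le.mp (hres i)).1, mul_self_nonneg (v i)]
  · have hsplit : ∀ i, s i * c x i = s i * v i * v i + (c x i - v i * v i) * s i :=
      fun i => by ring
    simp only [hsplit]
    exact (sqrt_sum_add_sq_le _ _).trans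
      (add_le_add (sqrt_sum_mul_sq_le _ _ hsv hV0 hv) (sqrt_sum_mul_sq_le _ _ h2 hS0 hs))
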